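/- arXiv:1403.8141 — 2 statements merged into one kernel-verified Lean document; each statement's English description precedes it below -/
import Mathlib

section
/- Let p, q, p', q' be natural numbers. If Ψ_S^{2p}·Ψ_T^{2q} = Ψ_{S'}^{2p'}·Ψ_{T'}^{2q'} holds in the ring Q, then p = q = p' = q' = 0. (This is the algebraic core of the proof that the image of m: π₁Ham(X)×π₁Ham(X̄) → π₁Ham(M) differs from the image of the analogous map m' for the second product decomposition, in the case where all four exponents are nonnegative.) -/
/- Λ₄ is the group algebra of ℝ⁴ over ℝ; `E β` is the Novikov monomial e^β,
   δ i the standard basis vectors of ℝ⁴.  `Q` is the Künneth model of the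
   quantum homology of M = (S²×S²)×(S²×S²) with form (ω₀⊕λω₀)⊕(−ω₀⊕−λω₀):
   the quotient of Λ₄[U₁,U₂,U₃,U₄] by U₁²−e^{−δ₁}, U₂²−e^{−δ₂}, U₃²−e^{δ₃},
   U₄²−e^{δ₄}; `u i` are the images of the variables (u₁,u₂,w₃,w₄). -/

noncomputable section

abbrev Λ₄ : Type := AddMonoidAlgebra ℝ (Fin 4 → ℝ)

def E (β : Fin 4 → ℝ) : Λ₄ := AddMonoidAlgebra.single β 1

def δ (i : Fin 4) : Fin 4 → ℝ := Pi.single i 1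

def qRel : Ideal (MvPolynomial (Fin 4) Λ₄) :=
  Ideal.span {MvPolynomial.X 0 ^ 2 - MvPolynomial.C (E (-δ 0)),
              MvPolynomial.X 1 ^ 2 - MvPolynomial.C (E (-δ 1)),
              MvPolynomial.X 2 ^ 2 - MvPolynomial.C (E (δ 2)),
              MvPolynomial.X 3 ^ 2 - MvPolynomial.C (E (δ 3))}

abbrev Q : Type := MvPolynomial (Fin 4) Λ₄ ⧸ qRel

def u (i : Fin 4) : Q := Ideal.Quotient.mk qRel (MvPolynomial.X i)

def eQ (β : Fin 4 → ℝ) : Q := algebraMap Λ₄ Q (E β)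

/-- Ψ_S = (u₁+u₂)·e^{(1/2+h)δ₁−hδ₂} -/
def ΨS (h : ℝ) : Q := (u 0 + u 1) * eQ ((1 / 2 + h) • δ 0 - h • δ 1)

/-- Ψ_T = −(w₃+w₄)·e^{−(1/2+h)δ₃+hδ₄} -/
def ΨT (h : ℝ) : Q := -((u 2 + u 3) * eQ (-((1 / 2 + h) • δ 2) + h • δ 3))

/-- Ψ_{S'} = (u₁−w₄)·e^{(1/2+h)δ₁+hδ₄} -/
def ΨS' (h : ℝ) : Q := (u 0 - u 3) * eQ ((1 / 2 + h) • δ 0 + h • δ 3)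

/-- Ψ_{T'} = (u₂−w₃)·e^{−(1/2+h)δ₃−hδ₂} -/
def ΨT' (h : ℝ) : Q := (u 1 - u 2) * eQ (-((1 / 2 + h) • δ 2) - h • δ 1)

/-- The augmentation of `Λ₄`, sending every Novikov monomial to `1`. -/
def augmentation : Λ₄ →+* ℝ :=
  (AddMonoidAlgebra.lift ℝ ℝ (Fin 4 → ℝ) 1).toRingHom

theorem augmentation_E (β : Fin 4 → ℝ) : augmentation (E β) = 1 := by
  simp [augmentation, E]

/-- Each choice of signs for `u₁, u₂, w₃, w₄` extends the augmentation to a real character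
of `Q`. -/
theorem exists_character (s : Fin 4 → ℝ) (hs : ∀ i, s i ^ 2 = 1) :
    ∃ χ : Q →+* ℝ, (∀ i, χ (u i) = s i) ∧ ∀ β, χ (eQ β) = 1 := by
  have hker : ∀ a ∈ qRel, MvPolynomial.eval₂Hom augmentation s a = 0 := by
    intro a ha
    change a ∈ RingHom.ker (MvPolynomial.eval₂Hom augmentation s)
    refine Ideal.span_le.2 ?_ ha
    rintro x (rfl | rfl | rfl | rfl) <;>
      simp [RingHom.mem_ker, hs, augmentation_E]
  refine ⟨Ideal.Quotient.lift qRel (MvPolynomial.eval₂Hom augmentation s) hker, ?_, ?_⟩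
  · intro i
    simp [u]
  · intro β
    change MvPolynomial.eval₂Hom augmentation s (MvPolynomial.C (E β)) = 1
    simp [augmentation_E]

/-- If Ψ_S^{2p}·Ψ_T^{2q} = Ψ_{S'}^{2p'}·Ψ_{T'}^{2q'} in Q then p = q = p' = q' = 0. -/
theorem seidel_products_equal_iff_trivial
    (lam : ℝ) (hlam : 1 < lam) (h : ℝ) (hh : h = 1 / (6 * lam * (lam - 1)))
    (p q p' q' : ℕ)
    (heq : ΨS h ^ (2 * p) * ΨT h ^ (2 * q) = ΨS' h ^ (2 * p') * ΨT' h ^ (2 * q')) :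
    p = 0 ∧ q = 0 ∧ p' = 0 ∧ q' = 0 := by
  obtain ⟨χ, hχ, hχE⟩ := exists_character ![1, -1, 1, -1] (by
    intro i
    fin_cases i <;> norm_num)
  obtain ⟨ψ, hψ, hψE⟩ := exists_character 1 (by simp)
  have hχ₀ : χ (u 0) = 1 := hχ 0
  have hχ₁ : χ (u 1) = -1 := hχ 1
  have hχ₂ : χ (u 2) = 1 := hχ 2
  have hχ₃ : χ (u 3) = -1 := hχ 3
  have hleft := congrArg χ heq
  have hright := congrArg ψ heq
  simp only [ΨS, ΨT, ΨS', ΨT', map_mul, map_pow, map_add, map_sub, map_neg, hχ₀, hχ₁,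
    hχ₂, hχ₃, hχE] at hleft
  simp only [ΨS, ΨT, ΨS', ΨT', map_mul, map_pow, map_add, map_sub, map_neg, hψ, hψE,
    Pi.one_apply] at hright
  have hp : p = 0 := by
    by_contra hne
    norm_num [hne] at hleft
  have hq : q = 0 := by
    by_contra hne
    norm_num [hne] at hleft
  have hp' : p' = 0 := by
    by_contra hne
    norm_num [hne] at hright
  have hq' : q' = 0 := by
    by_contra hne
    norm_num [hne] at hright
  exact ⟨hp, hq, hp', hq'⟩

end
end

section
/- In Q, set Ψ_{R₁} = u₁·e^{(1/2)δ₁}, Ψ_{R₂} = u₂·e^{(1/2)δ₂}, Ψ_{R̄₁} = −w₃·e^{−(1/2)δ₃}, Ψ_{R̄₂} = −w₄·e^{−(1/2)δ₄} (the Seidel elements of the order-two rotation loops R₁, R₂, R̄₁, R̄₂). Then Ψ_{R₁}² = Ψ_{R₂}² = Ψ_{R̄₁}² = Ψ_{R̄₂}² = 1, and consequently for all ε₁, ε₂, ε₃, ε₄ ∈ {0,1} and all natural numbers p, q, the square of σ = Ψ_{R₁}^{ε₁}·Ψ_{R₂}^{ε₂}·Ψ_{R̄₁}^{ε₃}·Ψ_{R̄₂}^{ε₄}·Ψ_S^{p}·Ψ_T^{q}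 equals Ψ_S^{2p}·Ψ_T^{2q}. -/
/- Λ₄ is the group algebra of ℝ⁴ over ℝ; `E β` is the Novikov monomial e^β,
   δ i the standard basis vectors of ℝ⁴.  `Q` is the Künneth model of the
   quantum homology of M = (S²×S²)×(S²×S²) with form (ω₀⊕λω₀)⊕(−ω₀⊕−λω₀):
   the quotient of Λ₄[U₁,U₂,U₃,U₄] by U₁²−e^{−δ₁}, U₂²−e^{−δ₂}, U₃²−e^{δ₃},
   U₄²−e^{δ₄}; `u i` are the images of the variables (u₁,u₂,w₃,w₄). -/

noncomputable section

/-- Ψ_{R₁} = u₁·e^{(1/2)δ₁} -/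
def ΨR₁ : Q := u 0 * eQ ((1 / 2 : ℝ) • δ 0)

/-- Ψ_{R₂} = u₂·e^{(1/2)δ₂} -/
def ΨR₂ : Q := u 1 * eQ ((1 / 2 : ℝ) • δ 1)

/-- Ψ_{R̄₁} = −w₃·e^{−(1/2)δ₃} -/
def ΨRb₁ : Q := -(u 2 * eQ (-((1 / 2 : ℝ) • δ 2)))

/-- Ψ_{R̄₂} = −w₄·e^{−(1/2)δ₄} -/
def ΨRb₂ : Q := -(u 3 * eQ (-((1 / 2 : ℝ) • δ 3)))

theorem eQ_zero : eQ 0 = 1 := map_one (algebraMap Λ₄ Q)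

theorem eQ_add (β γ : Fin 4 → ℝ) : eQ (β + γ) = eQ β * eQ γ := by
  rw [eQ, eQ, eQ, ← map_mul, E, E, E, AddMonoidAlgebra.single_mul_single, one_mul]

theorem u_sq_of_mem {i : Fin 4} {β : Fin 4 → ℝ}
    (hi : MvPolynomial.X i ^ 2 - MvPolynomial.C (E β) ∈ qRel) : u i ^ 2 = eQ β := by
  rw [u, ← map_pow]
  exact Ideal.Quotient.eq.mpr hi

theorem u_zero_sq : u 0 ^ 2 = eQ (-δ 0) := u_sq_of_mem (Ideal.subset_span (by simp))

theorem u_one_sq : u 1 ^ 2 = eQ (-δ 1) := u_sq_of_mem (Ideal.subset_span (by simp))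

theorem u_two_sq : u 2 ^ 2 = eQ (δ 2) := u_sq_of_mem (Ideal.subset_span (by simp))

theorem u_three_sq : u 3 ^ 2 = eQ (δ 3) := u_sq_of_mem (Ideal.subset_span (by simp))

theorem mul_sq_eq_one {R : Type*} [CommRing R] {x a b : R} (hx : x ^ 2 = b)
    (hab : b * (a * a) = 1) : (x * a) ^ 2 = 1 := by
  rw [mul_pow, hx, sq, hab]

theorem mul_pow_sq_of_sq_eq_one {R : Type*} [CommRing R] {a b c d : R} (ha : a ^ 2 = 1)
    (hb : b ^ 2 = 1) (hc : c ^ 2 = 1) (hd : d ^ 2 = 1) (x y : R) (k l m n p q : ℕ) :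
    (a ^ k * b ^ l * c ^ m * d ^ n * x ^ p * y ^ q) ^ 2 = x ^ (2 * p) * y ^ (2 * q) := by
  simp only [mul_pow, pow_right_comm _ _ 2, ha, hb, hc, hd, one_pow, one_mul, pow_mul]

/-- If `x² = e^β` and `β + 2γ = 0`, then `x·e^γ` squares to `1`. -/
theorem mul_eQ_sq_eq_one {x : Q} {β γ : Fin 4 → ℝ} (hx : x ^ 2 = eQ β)
    (hβγ : β + (γ + γ) = 0) : (x * eQ γ) ^ 2 = 1 :=
  mul_sq_eq_one (R := Q) hx (by rw [← eQ_add, ← eQ_add, hβγ, eQ_zero])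

theorem ΨR₁_sq : ΨR₁ ^ 2 = 1 := mul_eQ_sq_eq_one u_zero_sq (by module)

theorem ΨR₂_sq : ΨR₂ ^ 2 = 1 := mul_eQ_sq_eq_one u_one_sq (by module)

theorem ΨRb₁_sq : ΨRb₁ ^ 2 = 1 :=
  (neg_sq _).trans (mul_eQ_sq_eq_one u_two_sq (by module))

theorem ΨRb₂_sq : ΨRb₂ ^ 2 = 1 :=
  (neg_sq _).trans (mul_eQ_sq_eq_one u_three_sq (by module))

/-- The Seidel elements of the rotation loops square to 1, and hence the square of
σ = Ψ_{R₁}^{ε₁}Ψ_{R₂}^{ε₂}Ψ_{R̄₁}^{ε₃}Ψ_{R̄₂}^{ε₄}Ψ_S^{p}Ψ_T^{q} equals Ψ_S^{2p}Ψ_T^{2q}. -/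
theorem rotation_seidel_square_one_and_sigma_squared
    (lam : ℝ) (hlam : 1 < lam) (h : ℝ) (hh : h = 1 / (6 * lam * (lam - 1))) :
    (ΨR₁ ^ 2 = 1 ∧ ΨR₂ ^ 2 = 1 ∧ ΨRb₁ ^ 2 = 1 ∧ ΨRb₂ ^ 2 = 1) ∧
    ∀ ε₁ ε₂ ε₃ ε₄ : ℕ, (ε₁ = 0 ∨ ε₁ = 1) → (ε₂ = 0 ∨ ε₂ = 1) →
      (ε₃ = 0 ∨ ε₃ = 1) → (ε₄ = 0 ∨ ε₄ = 1) → ∀ p q : ℕ,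
      (ΨR₁ ^ ε₁ * ΨR₂ ^ ε₂ * ΨRb₁ ^ ε₃ * ΨRb₂ ^ ε₄ * ΨS h ^ p * ΨT h ^ q) ^ 2
        = ΨS h ^ (2 * p) * ΨT h ^ (2 * q) := by
  refine ⟨⟨ΨR₁_sq, ΨR₂_sq, ΨRb₁_sq, ΨRb₂_sq⟩, ?_⟩
  intro ε₁ ε₂ ε₃ ε₄ _ _ _ _ p q
  exact mul_pow_sq_of_sq_eq_one (R := Q) ΨR₁_sq ΨR₂_sq ΨRb₁_sq ΨRb₂_sq _ _ _ _ _ _ _ _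

end
end
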